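/- Let n ≥ 8 and τ be integers with n² − 3n ≤ τ ≤ n² − 2n − 1, and set σ = n² − τ (so 2n + 1 ≤ σ ≤ 3n). Assume σ − 2n ≡ 0 (mod 3) and 3n − σ is even. Then μ(n,τ) = 6^{(σ−2n)/3} · 2^{(3n−σ)/2}, and for A ∈ 𝒰(n,τ), per A = μ(n,τ) if and only if A is combinatorially equivalent to F_{n,σ}, the block-diagonal direct sum of (σ−2n)/3 copies of J_3 followed by (3n−σ)/2 copies of J_2. -/

import Mathlib

open scoped BigOperators

namespace BGM

/-- The permanent of a square matrix with natural number entries. -/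
def perm {n : ℕ} (M : Matrix (Fin n) (Fin n) ℕ) : ℕ :=
  ∑ φ : Equiv.Perm (Fin n), ∏ i, M i (φ i)

/-- `M` is a (0,1)-matrix. -/
def IsZeroOne {n : ℕ} (M : Matrix (Fin n) (Fin n) ℕ) : Prop :=
  ∀ i j, M i j = 0 ∨ M i j = 1

/-- The number of entries of `M` equal to `0`. -/
def zeroCount {n : ℕ} (M : Matrix (Fin n) (Fin n) ℕ) : ℕ :=
  (Finset.univ.filter fun p : Fin n × Fin n => M p.1 p.2 = 0).card

/-- `𝒰(n, τ)`: the n×n (0,1)-matrices with exactly τ zero entries. -/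
def Uclass (n τ : ℕ) : Set (Matrix (Fin n) (Fin n) ℕ) :=
  {M | IsZeroOne M ∧ zeroCount M = τ}

/-- `μ(n, τ) = max {per A : A ∈ 𝒰(n, τ)}`. -/
noncomputable def mu (n τ : ℕ) : ℕ :=
  sSup (perm '' Uclass n τ)

/-- `𝒜(n, k)`: the n×n (0,1)-matrices with exactly k ones in each row and column. -/
def Aclass (n k : ℕ) : Set (Matrix (Fin n) (Fin n) ℕ) :=
  {M | IsZeroOne M ∧ (∀ i, ∑ j, M i j = k) ∧ (∀ j, ∑ i, M i j = k)}

/-- `P` is a permutation matrix. -/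
def IsPermMatrix {n : ℕ} (P : Matrix (Fin n) (Fin n) ℕ) : Prop :=
  ∃ e : Equiv.Perm (Fin n), ∀ i j, P i j = if j = e i then 1 else 0

/-- `A` and `B` are combinatorially equivalent: `B = PAQ` or `B = PAᵀQ` for
permutation matrices `P`, `Q`. -/
def CombEquiv {n : ℕ} (A B : Matrix (Fin n) (Fin n) ℕ) : Prop :=
  ∃ P Q, IsPermMatrix P ∧ IsPermMatrix Q ∧ (B = P * A * Q ∨ B = P * A.transpose * Q)

/-- Index of the block (of consecutive sizes `L`) containing position `i`. -/
def blockIdx : List ℕ → ℕ → ℕ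
  | [], _ => 0
  | s :: L, i => if i < s then 0 else blockIdx L (i - s) + 1

/-- The n×n block-diagonal direct sum of all-ones blocks of sizes `L`
(with `L.sum = n`). -/
def listBlocks (n : ℕ) (L : List ℕ) : Matrix (Fin n) (Fin n) ℕ :=
  Matrix.of fun i j => if blockIdx L (i : ℕ) = blockIdx L (j : ℕ) then 1 else 0

/-- The n×n block-diagonal matrix with a head block `B` (of size `m`) followed by
all-ones blocks of sizes `L` (with `m + L.sum = n`). -/
def headBlocks (n : ℕ) {m : ℕ} (B : Matrix (Fin m) (Fin m) ℕ) (L : List ℕ) :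
    Matrix (Fin n) (Fin n) ℕ :=
  Matrix.of fun i j =>
    if h : (i : ℕ) < m ∧ (j : ℕ) < m then B ⟨(i : ℕ), h.1⟩ ⟨(j : ℕ), h.2⟩
    else if m ≤ (i : ℕ) ∧ m ≤ (j : ℕ) ∧
        blockIdx L ((i : ℕ) - m) = blockIdx L ((j : ℕ) - m) then 1 else 0

/-- `M` with the `(i0, j0)` entry changed to `1`. -/
def setOne {n : ℕ} (M : Matrix (Fin n) (Fin n) ℕ) (i0 j0 : Fin n) :
    Matrix (Fin n) (Fin n) ℕ :=
  Matrix.of fun i j => if i = i0 ∧ j = j0 then 1 else M i j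

/-- `J₃ - I₃`. -/
def J3mI3 : Matrix (Fin 3) (Fin 3) ℕ := Matrix.of fun i j => if i = j then 0 else 1

/-- `J₄ - I₄`. -/
def J4mI4 : Matrix (Fin 4) (Fin 4) ℕ := Matrix.of fun i j => if i = j then 0 else 1

/-- `A₃`: the 3×3 all-ones matrix except the (1,1) entry is 0. -/
def A3 : Matrix (Fin 3) (Fin 3) ℕ := Matrix.of fun i j => if i = 0 ∧ j = 0 then 0 else 1

/-- `A₃ ⊕ I₂`. -/
def V5 : Matrix (Fin 5) (Fin 5) ℕ :=
  !![0,1,1,0,0; 1,1,1,0,0; 1,1,1,0,0; 0,0,0,1,0; 0,0,0,0,1]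

/-- `J₃ ⊕ I₂`. -/
def S5 : Matrix (Fin 5) (Fin 5) ℕ :=
  !![1,1,1,0,0; 1,1,1,0,0; 1,1,1,0,0; 0,0,0,1,0; 0,0,0,0,1]

/-- The head block of `W`. -/
def BW : Matrix (Fin 4) (Fin 4) ℕ :=
  !![0,0,1,1; 1,1,0,1; 1,1,1,0; 1,1,0,1]

/-- The head block of `X`. -/
def BX : Matrix (Fin 4) (Fin 4) ℕ :=
  !![0,0,1,1; 1,0,1,1; 1,1,0,1; 1,1,1,0]

/-- The head block of `Y`. -/
def BY : Matrix (Fin 4) (Fin 4) ℕ :=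
  !![0,0,1,1; 1,0,1,1; 1,1,0,0; 1,1,1,1]

/-- `A₃ ⊕ I₁`. -/
def T4 : Matrix (Fin 4) (Fin 4) ℕ :=
  !![0,1,1,0; 1,1,1,0; 1,1,1,0; 0,0,0,1]

/-- `A₄ ⊕ J₂`, where `A₄` is `J₄` with the (1,1) entry changed to 0. -/
def Q6 : Matrix (Fin 6) (Fin 6) ℕ :=
  !![0,1,1,1,0,0; 1,1,1,1,0,0; 1,1,1,1,0,0; 1,1,1,1,0,0; 0,0,0,0,1,1; 0,0,0,0,1,1]

/-- `J₃ ⊕ I₁`. -/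
def M4 : Matrix (Fin 4) (Fin 4) ℕ :=
  !![1,1,1,0; 1,1,1,0; 1,1,1,0; 0,0,0,1]

set_option linter.unusedSectionVars false

def RR {α : Type} (A : α → α → Bool) (T : Finset α) (i : α) : Finset α := T.filter (fun j => A i j = true)
def CC {α : Type} (A : α → α → Bool) (S : Finset α) (j : α) : Finset α := S.filter (fun i => A i j = true)
def tr {α : Type} (A : α → α → Bool) : α → α → Bool := fun i j => A j i
def EE {α : Type} (A : α → α → Bool) (S T : Finset α) : ℕ := ∑ i ∈ S, (RR A T i).card
noncomputable def NN {α : Type} (A : α → α → Bool) (S T : Finset α) : ℕ :=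
  Nat.card {φ : S ≃ T // ∀ i : S, A i (φ i) = true}

section
variable {α : Type} [DecidableEq α] (A : α → α → Bool) (S T : Finset α)

lemma mem_RR {A : α → α → Bool} {T : Finset α} {i j : α} : j ∈ RR A T i ↔ j ∈ T ∧ A i j = true := by
  simp [RR]
lemma mem_CC {A : α → α → Bool} {S : Finset α} {i j : α} : i ∈ CC A S j ↔ i ∈ S ∧ A i j = true := by
  simp [CC]

lemma EE_tr : EE (tr A) T S = EE A S T := by
  unfold EE RR tr
  simp only [Finset.card_filter]
  rw [Finset.sum_comm]

lemma EE_cols : EE A S T = ∑ j ∈ T, (CC A S j).card := by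
  rw [← EE_tr]; rfl

lemma NN_tr : NN (tr A) T S = NN A S T := by
  unfold NN
  apply Nat.card_congr
  refine ⟨fun φ => ⟨φ.1.symm, fun i => ?_⟩, fun φ => ⟨φ.1.symm, fun i => ?_⟩, fun φ => ?_, fun φ => ?_⟩
  · have := φ.2 (φ.1.symm i); simpa [tr] using this
  · have := φ.2 (φ.1.symm i); simpa [tr] using this
  · simp
  · simp

lemma RR_erase (i j : α) : RR A (T.erase j) i = (RR A T i).erase j := by
  unfold RR; rw [Finset.filter_erase]
lemma CC_erase (i j : α) : CC A (S.erase i) j = (CC A S j).erase i := by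
  unfold CC; rw [Finset.filter_erase]

lemma EE_erase {i j : α} (hi : i ∈ S) (hj : j ∈ T) (h : A i j = true) :
    EE A S T + 1 = EE A (S.erase i) (T.erase j) + (RR A T i).card + (CC A S j).card := by
  have h1 : EE A S T = EE A (S.erase i) T + (RR A T i).card := by
    unfold EE; rw [Finset.sum_erase_add _ _ hi]
  have h2 : EE A (S.erase i) T = EE A (S.erase i) (T.erase j) + (CC A (S.erase i) j).card := by
    rw [EE_cols, EE_cols, Finset.sum_erase_add _ _ hj]
  have h3 : (CC A (S.erase i) j).card + 1 = (CC A S j).card := by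
    rw [CC_erase, Finset.card_erase_add_one (mem_CC.2 ⟨hi, h⟩)]
  omega

lemma NN_row {i : α} (hi : i ∈ S) :
    NN A S T ≤ ∑ j ∈ RR A T i, NN A (S.erase i) (T.erase j) := by
  classical
  unfold NN
  rw [Nat.card_eq_fintype_card, ← Finset.card_univ]
  rw [Finset.card_eq_sum_card_fiberwise (f := fun φ => (φ.1 ⟨i, hi⟩ : α)) (t := RR A T i)]
  · apply Finset.sum_le_sum
    intro j _
    rw [Nat.card_eq_fintype_card, ← Fintype.card_coe]
    have key : ∀ (φ : S ≃ T), ((φ ⟨i, hi⟩ : T) : α) = j → ∀ (x : S.erase i),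
        ((φ ⟨x, Finset.mem_of_mem_erase x.2⟩ : T) : α) ∈ T.erase j := by
      intro φ h x
      refine Finset.mem_erase.2 ⟨fun hh => ?_, (φ _).2⟩
      rw [← h] at hh
      have := φ.injective (Subtype.ext hh)
      exact (Finset.mem_erase.1 x.2).1 (congrArg Subtype.val this)
    have key2 : ∀ (φ : S ≃ T), ((φ ⟨i, hi⟩ : T) : α) = j → ∀ (y : T.erase j),
        ((φ.symm ⟨y, Finset.mem_of_mem_erase y.2⟩ : S) : α) ∈ S.erase i := by
      intro φ h y
      refine Finset.mem_erase.2 ⟨fun hh => ?_, (φ.symm _).2⟩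
      have : φ.symm ⟨y, Finset.mem_of_mem_erase y.2⟩ = ⟨i, hi⟩ := Subtype.ext hh
      rw [Equiv.symm_apply_eq] at this
      rw [← this] at h
      exact (Finset.mem_erase.1 y.2).1 h
    let F : {x // x ∈ Finset.filter (fun φ : {φ : S ≃ T // ∀ i : S, A i (φ i) = true} => (φ.1 ⟨i, hi⟩ : α) = j) Finset.univ} →
        {φ : (S.erase i : Finset α) ≃ (T.erase j : Finset α) // ∀ i : (S.erase i : Finset α), A i (φ i) = true} :=
      fun φ => ⟨{ toFun := fun x => ⟨_, key φ.1.1 (Finset.mem_filter.1 φ.2).2 x⟩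
                  invFun := fun y => ⟨_, key2 φ.1.1 (Finset.mem_filter.1 φ.2).2 y⟩
                  left_inv := fun x => by simp
                  right_inv := fun x => by simp }, fun x => φ.1.2 ⟨x, Finset.mem_of_mem_erase x.2⟩⟩
    apply Fintype.card_le_of_injective F
    intro φ ψ h
    apply Subtype.ext; apply Subtype.ext; apply Equiv.ext
    intro x
    by_cases hx : (x : α) = i
    · have e : x = ⟨i, hi⟩ := Subtype.ext hx
      apply Subtype.ext
      rw [e, (Finset.mem_filter.1 φ.2).2, (Finset.mem_filter.1 ψ.2).2]
    · have h1 := congrArg Subtype.val h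
      have h2 := congrArg (fun e => ((e ⟨x, Finset.mem_erase.2 ⟨hx, x.2⟩⟩ : (T.erase j : Finset α)) : α)) h1
      exact Subtype.ext h2
  · intro φ _
    simp only [Finset.mem_coe]
    exact mem_RR.2 ⟨(φ.1 _).2, φ.2 ⟨i, hi⟩⟩

lemma NN_col {j : α} (hj : j ∈ T) :
    NN A S T ≤ ∑ i ∈ CC A S j, NN A (S.erase i) (T.erase j) := by
  have := NN_row (tr A) T S hj
  simp only [NN_tr] at this
  exact this

/-- block structure -/
def Good : Prop :=
  (∀ i ∈ S, (RR A T i).card = 2 ∨ (RR A T i).card = 3) ∧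
  (∀ j ∈ T, (CC A S j).card = 2 ∨ (CC A S j).card = 3) ∧
  (∀ i ∈ S, ∀ j ∈ T, A i j = true → (RR A T i).card = (CC A S j).card) ∧
  (∀ i ∈ S, ∀ i' ∈ S, ∀ j ∈ T, ∀ j' ∈ T, A i j = true → A i' j = true → A i j' = true → A i' j' = true)

lemma Good_tr (h : Good (tr A) T S) : Good A S T := by
  obtain ⟨h1, h2, h3, h4⟩ := h
  refine ⟨h2, h1, fun i hi j hj h => (h3 j hj i hi h).symm, ?_⟩
  intro i hi i' hi' j hj j' hj' a b c
  exact h4 j hj j' hj' i hi i' hi' a c b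

noncomputable def pp : ℝ := (2/9 : ℝ) ^ (1/6 : ℝ)
lemma pp6 : pp ^ 6 = 2/9 := by
  unfold pp
  rw [← Real.rpow_natCast, ← Real.rpow_mul (by norm_num)]; norm_num
lemma pp_pos : 0 < pp := by unfold pp; positivity
lemma pp_lo : 0.778 < pp := by
  have := pp6
  by_contra! h
  have := pow_le_pow_left₀ pp_pos.le h 6
  norm_num at this; linarith
lemma pp_hi : pp < 0.779 := by
  have := pp6
  by_contra! h
  have := pow_le_pow_left₀ (by norm_num) h 6
  norm_num at this; linarith
noncomputable def cc : ℝ := 3 * pp ^ 5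
lemma cc_pos : 0 < cc := by unfold cc; have := pp_pos; positivity
lemma cc_sq : cc ^ 2 = 2 * pp ^ 4 := by
  unfold cc
  have : (3 * pp^5)^2 = 9 * pp^6 * pp^4 := by ring
  rw [this, pp6]; ring
lemma num1 : pp < cc := by
  unfold cc
  have h := pp_lo
  have h1 : (0.778:ℝ)^4 ≤ pp^4 := pow_le_pow_left₀ (by norm_num) h.le 4
  have h2 : 1 < 3 * pp^4 := by norm_num at h1; linarith
  nlinarith [pp_pos]
lemma num2 : pp ^ 3 + pp ^ 4 < cc := by
  unfold cc
  have h := pp_lo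
  have h' := pp_hi
  have : 1 + pp < 3 * pp^2 := by nlinarith
  have h3 : 0 < pp^3 := pow_pos pp_pos 3
  nlinarith
lemma num4 (r : ℕ) (hr : 4 ≤ r) : r * pp ^ (r + 3) < cc := by
  induction r, hr using Nat.le_induction with
  | base =>
    unfold cc
    have h3 : 0 < pp^5 := pow_pos pp_pos 5
    have : 4 * pp^2 < 3 := by nlinarith [pp_hi, pp_pos]
    push_cast
    nlinarith
  | succ r hr ih =>
    refine lt_of_le_of_lt ?_ ih
    have h3 : 0 < pp^(r+3) := pow_pos pp_pos _
    have h4 : (4:ℝ) ≤ r := by exact_mod_cast hr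
    have : (r+1) * pp ≤ r := by nlinarith [pp_hi, pp_pos]
    push_cast
    calc ((r:ℝ)+1) * pp^(r+1+3) = ((r+1)*pp) * pp^(r+3) := by ring
      _ ≤ _ := by gcongr

noncomputable def WW (m e : ℕ) : ℝ := cc ^ m * pp⁻¹ ^ e
lemma WW_pos (m e : ℕ) : 0 < WW m e := by
  unfold WW; have := cc_pos; have := pp_pos; positivity
lemma WW_shift (m e d : ℕ) : WW m e = WW m (e+d) * pp^d := by
  unfold WW
  have := pp_pos
  rw [pow_add, inv_pow, inv_pow]
  field_simp
lemma WW_succ (m e : ℕ) : WW (m+1) e = WW m e * cc := by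
  unfold WW; ring

def Claim (m : ℕ) : Prop :=
  (NN A S T : ℝ) ≤ WW m (EE A S T) ∧ ((NN A S T : ℝ) = WW m (EE A S T) → Good A S T)

lemma Claim_tr {m : ℕ} (h : Claim (tr A) T S m) : Claim A S T m := by
  unfold Claim at *
  rw [NN_tr, EE_tr] at h
  exact ⟨h.1, fun e => Good_tr _ _ _ (h.2 e)⟩

lemma Claim_of_lt {m : ℕ} (h : (NN A S T : ℝ) < WW m (EE A S T)) : Claim A S T m :=
  ⟨h.le, fun e => absurd e h.ne⟩

/-- one-step estimate -/
lemma step {m : ℕ} (i j : α) (hi : i ∈ S) (hj : j ∈ T) (h : A i j = true)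
    (ih : Claim A (S.erase i) (T.erase j) m) (d : ℕ)
    (hd : d + 1 ≤ (RR A T i).card + (CC A S j).card) :
    (NN A (S.erase i) (T.erase j) : ℝ) ≤ WW m (EE A S T) * pp ^ d := by
  have h1 := EE_erase A S T hi hj h
  obtain ⟨x, hx⟩ := Nat.exists_eq_add_of_le hd
  have h2 : EE A S T = EE A (S.erase i) (T.erase j) + (d + x) := by omega
  refine ih.1.trans ?_
  rw [WW_shift _ _ (d+x), ← h2, pow_add]
  have : pp ^ x ≤ 1 := pow_le_one₀ pp_pos.le (by linarith [pp_hi])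
  have h3 : 0 < pp ^ d := pow_pos pp_pos _
  have := WW_pos m (EE A S T)
  apply mul_le_mul_of_nonneg_left _ this.le
  nlinarith

lemma L1 {m : ℕ} (ih : ∀ i ∈ S, ∀ j ∈ T, Claim A (S.erase i) (T.erase j) m)
    (i : α) (hi : i ∈ S) (h : (RR A T i).card ≤ 1) : Claim A S T (m+1) := by
  apply Claim_of_lt
  have h0 := NN_row A S T hi
  have h0' : (NN A S T : ℝ) ≤ ∑ j ∈ RR A T i, (NN A (S.erase i) (T.erase j) : ℝ) := by exact_mod_cast h0
  refine h0'.trans_lt ?_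
  have hW := WW_pos m (EE A S T)
  rw [WW_succ]
  have hb : ∀ j ∈ RR A T i, (NN A (S.erase i) (T.erase j) : ℝ) ≤ WW m (EE A S T) * pp := by
    intro j hj
    have hj' := mem_RR.1 hj
    have := step A S T i j hi hj'.1 hj'.2 (ih i hi j hj'.1) 1 (by
      have : 0 < (RR A T i).card := Finset.card_pos.2 ⟨j, hj⟩
      have : 0 < (CC A S j).card := Finset.card_pos.2 ⟨i, mem_CC.2 ⟨hi, hj'.2⟩⟩
      omega)
    simpa using this
  refine (Finset.sum_le_card_nsmul _ _ _ hb).trans_lt ?_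
  rw [nsmul_eq_mul]
  have : ((RR A T i).card : ℝ) ≤ 1 := by exact_mod_cast h
  have := pp_pos
  have := num1
  have h5 : 0 < WW m (EE A S T) * pp := by positivity
  have h6 : WW m (EE A S T) * pp < WW m (EE A S T) * cc := by gcongr
  nlinarith

lemma L4 {m : ℕ} (ih : ∀ i ∈ S, ∀ j ∈ T, Claim A (S.erase i) (T.erase j) m)
    (i : α) (hi : i ∈ S) (h : 4 ≤ (RR A T i).card) (hc : ∀ j ∈ T, 4 ≤ (CC A S j).card) :
    Claim A S T (m+1) := by
  apply Claim_of_lt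
  have h0 := NN_row A S T hi
  have h0' : (NN A S T : ℝ) ≤ ∑ j ∈ RR A T i, (NN A (S.erase i) (T.erase j) : ℝ) := by exact_mod_cast h0
  refine h0'.trans_lt ?_
  have hW := WW_pos m (EE A S T)
  rw [WW_succ]
  have hb : ∀ j ∈ RR A T i, (NN A (S.erase i) (T.erase j) : ℝ) ≤
      WW m (EE A S T) * pp ^ ((RR A T i).card + 3) := by
    intro j hj
    have hj' := mem_RR.1 hj
    exact step A S T i j hi hj'.1 hj'.2 (ih i hi j hj'.1) _ (by
      have := hc j hj'.1
      omega)
  refine (Finset.sum_le_card_nsmul _ _ _ hb).trans_lt ?_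
  rw [nsmul_eq_mul]
  have := num4 _ h
  have h6 : WW m (EE A S T) * (((RR A T i).card : ℝ) * pp ^ ((RR A T i).card + 3)) < WW m (EE A S T) * cc := by gcongr
  linarith

lemma L3 {m : ℕ} (hS : S.card = m+1) (hT : T.card = m+1)
    (ih : ∀ i ∈ S, ∀ j ∈ T, Claim A (S.erase i) (T.erase j) m)
    (i : α) (hi : i ∈ S) (h : (RR A T i).card = 3) (hr : ∀ i ∈ S, 3 ≤ (RR A T i).card)
    (hc : ∀ j ∈ T, 3 ≤ (CC A S j).card) :
    Claim A S T (m+1) := by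
  have h0 := NN_row A S T hi
  have h0' : (NN A S T : ℝ) ≤ ∑ j ∈ RR A T i, (NN A (S.erase i) (T.erase j) : ℝ) := by exact_mod_cast h0
  have hW := WW_pos m (EE A S T)
  have hb : ∀ j ∈ RR A T i, (NN A (S.erase i) (T.erase j) : ℝ) ≤
      WW m (EE A S T) * pp ^ 5 := by
    intro j hj
    have hj' := mem_RR.1 hj
    exact step A S T i j hi hj'.1 hj'.2 (ih i hi j hj'.1) _ (by
      have := hc j hj'.1
      omega)
  have hs := Finset.sum_le_card_nsmul _ _ _ hb
  have hs' : (RR A T i).card • (WW m (EE A S T) * pp ^ 5) = WW (m+1) (EE A S T) := by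
    rw [h, WW_succ, nsmul_eq_mul]; unfold cc; push_cast; ring
  rw [hs'] at hs
  refine ⟨h0'.trans hs, fun heq => ?_⟩
  have hseq : ∑ j ∈ RR A T i, (NN A (S.erase i) (T.erase j) : ℝ) =
      ∑ j ∈ RR A T i, WW m (EE A S T) * pp ^ 5 := by
    rw [Finset.sum_const, hs']; linarith
  rw [Finset.sum_eq_sum_iff_of_le hb] at hseq
  have hc3 : ∀ j ∈ RR A T i, (CC A S j).card = 3 := by
    intro j hj
    have hj' := mem_RR.1 hj
    by_contra hne
    have h4 := hc j hj'.1
    have := step A S T i j hi hj'.1 hj'.2 (ih i hi j hj'.1) 6 (by omega)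
    rw [hseq j hj] at this
    have h5 : pp^6 < pp^5 := by
      have := pow_pos pp_pos 5
      nlinarith [pp_hi]
    have : WW m (EE A S T) * pp ^ 6 < WW m (EE A S T) * pp ^ 5 := by gcongr
    linarith
  obtain ⟨j1, hj1⟩ : (RR A T i).Nonempty := Finset.card_pos.1 (by omega)
  obtain ⟨hj1T, hj1A⟩ := mem_RR.1 hj1
  have hG : Good A (S.erase i) (T.erase j1) := by
    apply (ih i hi j1 hj1T).2
    rw [hseq j1 hj1, WW_shift m (EE A (S.erase i) (T.erase j1)) 5]
    have := EE_erase A S T hi hj1T hj1A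
    rw [hc3 j1 hj1, h] at this
    congr 2; omega
  obtain ⟨g1, g2, g3, g4⟩ := hG
  have hcall : ∀ j ∈ T, (CC A S j).card = 3 := by
    intro j hj
    by_cases hji : A i j = true
    · exact hc3 j (mem_RR.2 ⟨hj, hji⟩)
    · have hne : j ≠ j1 := by rintro rfl; exact hji hj1A
      have := g2 j (Finset.mem_erase.2 ⟨hne, hj⟩)
      rw [CC_erase, Finset.erase_eq_of_notMem (fun h => hji (mem_CC.1 h).2)] at this
      have := hc j hj
      omega
  have hrall : ∀ k ∈ S, (RR A T k).card = 3 := by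
    have e1 : EE A S T = ∑ _k ∈ S, 3 := by
      rw [EE_cols, Finset.sum_congr rfl hcall, Finset.sum_const, Finset.sum_const, hS, hT]
    unfold EE at e1
    have := (Finset.sum_eq_sum_iff_of_le hr).1 e1.symm
    exact fun k hk => (this k hk).symm
  have star : ∀ k ∈ S, k ≠ i → ∀ j ∈ T, j ≠ j1 → A k j = true → (A k j1 = true ↔ A i j = true) := by
    intro k hk hki j hj hjj hkj
    have := g3 k (Finset.mem_erase.2 ⟨hki, hk⟩) j (Finset.mem_erase.2 ⟨hjj, hj⟩) hkj
    rw [RR_erase, CC_erase, Finset.card_erase_eq_ite, Finset.card_erase_eq_ite, hrall k hk, hcall j hj] at this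
    have q1 : j1 ∈ RR A T k ↔ A k j1 = true := by rw [mem_RR]; exact and_iff_right hj1T
    have q2 : i ∈ CC A S j ↔ A i j = true := by rw [mem_CC]; exact and_iff_right hi
    simp only [q1, q2] at this
    by_cases a : A k j1 = true <;> by_cases b : A i j = true
    · exact ⟨fun _ => b, fun _ => a⟩
    · rw [if_pos a, if_neg b] at this; omega
    · rw [if_neg a, if_pos b] at this; omega
    · exact ⟨fun x => absurd x a, fun x => absurd x b⟩
  have X : ∀ k ∈ S, A k j1 = true → RR A T k = RR A T i := by
    intro k hk hkj
    by_cases hki : k = i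
    · rw [hki]
    apply Finset.eq_of_subset_of_card_le
    · intro j hj
      obtain ⟨hjT, hjA⟩ := mem_RR.1 hj
      by_cases hjj : j = j1
      · rw [hjj]; exact hj1
      · exact mem_RR.2 ⟨hjT, (star k hk hki j hjT hjj hjA).1 hkj⟩
    · rw [hrall k hk, hrall i hi]
  have Y : ∀ k ∈ S, ∀ a ∈ RR A T i, A k a = true → RR A T k = RR A T i := by
    intro k hk a ha hka
    obtain ⟨haT, haA⟩ := mem_RR.1 ha
    by_cases hki : k = i
    · rw [hki]
    by_cases haj : a = j1
    · exact X k hk (haj ▸ hka)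
    · exact X k hk ((star k hk hki a haT haj hka).2 haA)
  refine ⟨fun k hk => Or.inr (hrall k hk), fun j hj => Or.inr (hcall j hj),
    fun k hk j hj _ => by rw [hrall k hk, hcall j hj], ?_⟩
  intro k hk k' hk' a ha b hb' h1 h2 h3
  by_cases hai : a ∈ RR A T i
  · have e1 := Y k hk a hai h1
    have e2 := Y k' hk' a hai h2
    have : b ∈ RR A T k' := by rw [e2, ← e1]; exact mem_RR.2 ⟨hb', h3⟩
    exact (mem_RR.1 this).2
  · have n1 : k ≠ i := by rintro rfl; exact hai (mem_RR.2 ⟨ha, h1⟩)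
    have n2 : k' ≠ i := by rintro rfl; exact hai (mem_RR.2 ⟨ha, h2⟩)
    have n3 : a ≠ j1 := by rintro rfl; exact hai hj1
    have n4 : b ≠ j1 := by
      rintro rfl
      have := X k hk h3
      exact hai (this ▸ mem_RR.2 ⟨ha, h1⟩)
    exact g4 k (Finset.mem_erase.2 ⟨n1, hk⟩) k' (Finset.mem_erase.2 ⟨n2, hk'⟩) a
      (Finset.mem_erase.2 ⟨n3, ha⟩) b (Finset.mem_erase.2 ⟨n4, hb'⟩) h1 h2 h3


lemma L2t {m : ℕ} (i j1 j2 : α) (hi : i ∈ S) (hj1 : j1 ∈ T) (hj2 : j2 ∈ T) (hne : j1 ≠ j2)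
    (h1 : A i j1 = true) (h2 : A i j2 = true) (hri : (RR A T i).card = 2)
    (hc1 : (CC A S j1).card = 2) (hc2 : (CC A S j2).card = 2)
    (hr : ∀ i ∈ S, 2 ≤ (RR A T i).card)
    (ih : ∀ k ∈ S, k ≠ i → Claim A ((S.erase i).erase k) ((T.erase j1).erase j2) m) :
    (NN A (S.erase i) (T.erase j1) : ℝ) ≤ WW m (EE A S T) * pp ^ 4 ∧
    ((NN A (S.erase i) (T.erase j1) : ℝ) = WW m (EE A S T) * pp ^ 4 →
      ∃ k ∈ S, k ≠ i ∧ A k j1 = true ∧ A k j2 = true ∧ (RR A T k).card = 2 ∧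
        Good A ((S.erase i).erase k) ((T.erase j1).erase j2)) := by
  have hE := EE_erase A S T hi hj1 h1
  have hcard : (CC A (S.erase i) j2).card = 1 := by
    rw [CC_erase, Finset.card_erase_of_mem (mem_CC.2 ⟨hi, h2⟩), hc2]
  obtain ⟨k, hk⟩ := Finset.card_eq_one.1 hcard
  have hkm : k ∈ CC A (S.erase i) j2 := by rw [hk]; simp
  obtain ⟨hkS', hkA⟩ := mem_CC.1 hkm
  obtain ⟨hki, hkS⟩ := Finset.mem_erase.1 hkS'
  have hj2T' : j2 ∈ T.erase j1 := Finset.mem_erase.2 ⟨hne.symm, hj2⟩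
  have hcol := NN_col A (S.erase i) (T.erase j1) hj2T'
  rw [hk, Finset.sum_singleton] at hcol
  have hcol' : (NN A (S.erase i) (T.erase j1) : ℝ) ≤
    NN A ((S.erase i).erase k) ((T.erase j1).erase j2) := by exact_mod_cast hcol
  have hst := step A (S.erase i) (T.erase j1) k j2 hkS' hj2T' hkA (ih k hkS hki)
  have hE' : WW m (EE A (S.erase i) (T.erase j1)) = WW m (EE A S T) * pp ^ 3 := by
    rw [WW_shift m (EE A (S.erase i) (T.erase j1)) 3]
    congr 2; omega
  rw [hE', hcard] at hst
  have hW := WW_pos m (EE A S T)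
  have hR1 : 0 < (RR A (T.erase j1) k).card := Finset.card_pos.2 ⟨j2, mem_RR.2 ⟨hj2T', hkA⟩⟩
  have b1 := hst 1 (by omega)
  refine ⟨hcol'.trans (b1.trans (le_of_eq (by ring))), fun heq => ?_⟩
  have hR : (RR A (T.erase j1) k).card = 1 := by
    by_contra hcon
    have b2 := hst 2 (by omega)
    have : pp^5 < pp^4 := by
      have := pow_pos pp_pos 4
      nlinarith [pp_hi]
    have : WW m (EE A S T) * pp^5 < WW m (EE A S T) * pp^4 := by gcongr
    have e : WW m (EE A S T) * pp^3 * pp^2 = WW m (EE A S T) * pp^5 := by ring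
    linarith
  have hrk := hr k hkS
  have hR' := hR
  rw [RR_erase, Finset.card_erase_eq_ite] at hR'
  have hj1k : j1 ∈ RR A T k := by
    by_contra hcon
    rw [if_neg hcon] at hR'; omega
  rw [if_pos hj1k] at hR'
  refine ⟨k, hkS, hki, (mem_RR.1 hj1k).2, hkA, by omega, (ih k hkS hki).2 ?_⟩
  have hE2 := EE_erase A (S.erase i) (T.erase j1) hkS' hj2T' hkA
  rw [hcard, hR] at hE2
  have : WW m (EE A ((S.erase i).erase k) ((T.erase j1).erase j2)) = WW m (EE A S T) * pp ^ 4 := by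
    rw [WW_shift m (EE A ((S.erase i).erase k) ((T.erase j1).erase j2)) 1,
      show EE A ((S.erase i).erase k) ((T.erase j1).erase j2) + 1 = EE A (S.erase i) (T.erase j1) by omega, hE']
    ring
  apply le_antisymm (ih k hkS hki).1
  rw [this, ← heq]; exact hcol'

lemma L2 {m : ℕ}
    (ih : ∀ i ∈ S, ∀ j ∈ T, Claim A (S.erase i) (T.erase j) (m+1))
    (ih2 : ∀ i ∈ S, ∀ k ∈ S, k ≠ i → ∀ j ∈ T, ∀ j' ∈ T, j' ≠ j →
      Claim A ((S.erase i).erase k) ((T.erase j).erase j') m)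
    (i : α) (hi : i ∈ S) (h : (RR A T i).card = 2) (hr : ∀ i ∈ S, 2 ≤ (RR A T i).card)
    (hc : ∀ j ∈ T, 2 ≤ (CC A S j).card) :
    Claim A S T (m+2) := by
  have h0 := NN_row A S T hi
  obtain ⟨j1, j2, hne, hj⟩ := Finset.card_eq_two.1 h
  obtain ⟨hj1, h1⟩ := mem_RR.1 (show j1 ∈ RR A T i by rw [hj]; simp)
  obtain ⟨hj2, h2⟩ := mem_RR.1 (show j2 ∈ RR A T i by rw [hj]; simp)
  rw [hj, Finset.sum_pair hne] at h0
  have h0' : (NN A S T : ℝ) ≤ NN A (S.erase i) (T.erase j1) + NN A (S.erase i) (T.erase j2) := by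
    exact_mod_cast h0
  have hc1 := hc j1 hj1
  have hc2 := hc j2 hj2
  have s1 := step A S T i j1 hi hj1 h1 (ih i hi j1 hj1)
  have s2 := step A S T i j2 hi hj2 h2 (ih i hi j2 hj2)
  have hW := WW_pos (m+1) (EE A S T)
  have n2 : WW (m+1) (EE A S T) * (pp^3+pp^4) < WW (m+1) (EE A S T) * cc := by
    have := num2
    gcongr
  by_cases e1 : (CC A S j1).card = 2
  swap
  · apply Claim_of_lt
    have t1 := s1 4 (by omega)
    have t2 := s2 3 (by omega)
    rw [WW_succ]
    linarith
  by_cases e2 : (CC A S j2).card = 2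
  swap
  · apply Claim_of_lt
    have t1 := s1 3 (by omega)
    have t2 := s2 4 (by omega)
    rw [WW_succ]
    linarith
  have u1 := L2t A S T (m := m) i j1 j2 hi hj1 hj2 hne h1 h2 h e1 e2 hr
    (fun k hk hki => ih2 i hi k hk hki j1 hj1 j2 hj2 hne.symm)
  have u2 := L2t A S T (m := m) i j2 j1 hi hj2 hj1 hne.symm h2 h1 h e2 e1 hr
    (fun k hk hki => ih2 i hi k hk hki j2 hj2 j1 hj1 hne)
  have hWW : WW (m+2) (EE A S T) = WW m (EE A S T) * pp^4 + WW m (EE A S T) * pp^4 := by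
    rw [WW_succ, WW_succ, mul_assoc, ← pow_two, cc_sq]; ring
  refine ⟨by linarith [u1.1, u2.1], fun heq => ?_⟩
  obtain ⟨k, hkS, hki, hk1, hk2, hrk, g1, g2, g3, g4⟩ := u1.2 (by linarith [u1.1, u2.1])
  have C1 : CC A S j1 = {i, k} := by
    symm
    apply Finset.eq_of_subset_of_card_le
    · intro x hx
      simp only [Finset.mem_insert, Finset.mem_singleton] at hx
      rcases hx with rfl | rfl
      · exact mem_CC.2 ⟨hi, h1⟩
      · exact mem_CC.2 ⟨hkS, hk1⟩
    · rw [e1, Finset.card_pair hki.symm]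
  have C2 : CC A S j2 = {i, k} := by
    symm
    apply Finset.eq_of_subset_of_card_le
    · intro x hx
      simp only [Finset.mem_insert, Finset.mem_singleton] at hx
      rcases hx with rfl | rfl
      · exact mem_CC.2 ⟨hi, h2⟩
      · exact mem_CC.2 ⟨hkS, hk2⟩
    · rw [e2, Finset.card_pair hki.symm]
  have Rk : RR A T k = {j1, j2} := by
    symm
    apply Finset.eq_of_subset_of_card_le
    · intro x hx
      simp only [Finset.mem_insert, Finset.mem_singleton] at hx
      rcases hx with rfl | rfl
      · exact mem_RR.2 ⟨hj1, hk1⟩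
      · exact mem_RR.2 ⟨hj2, hk2⟩
    · rw [hrk, Finset.card_pair hne]
  -- rows in the block meet exactly the columns in the block
  have blk : ∀ x ∈ S, ∀ y ∈ T, A x y = true → ((x = i ∨ x = k) ↔ (y = j1 ∨ y = j2)) := by
    intro x hx y hy hxy
    constructor
    · rintro (rfl | rfl)
      · have : y ∈ RR A T x := mem_RR.2 ⟨hy, hxy⟩
        rw [hj] at this; simpa using this
      · have : y ∈ RR A T x := mem_RR.2 ⟨hy, hxy⟩
        rw [Rk] at this; simpa using this
    · rintro (rfl | rfl)
      · have : x ∈ CC A S y := mem_CC.2 ⟨hx, hxy⟩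
        rw [C1] at this; simpa using this
      · have : x ∈ CC A S y := mem_CC.2 ⟨hx, hxy⟩
        rw [C2] at this; simpa using this
  have memS : ∀ x, x ∈ (S.erase i).erase k ↔ x ∈ S ∧ ¬ (x = i ∨ x = k) := by
    intro x; simp only [Finset.mem_erase]; tauto
  have memT : ∀ x, x ∈ (T.erase j1).erase j2 ↔ x ∈ T ∧ ¬ (x = j1 ∨ x = j2) := by
    intro x; simp only [Finset.mem_erase]; tauto
  have RRe : ∀ x ∈ S, ¬ (x = i ∨ x = k) → RR A ((T.erase j1).erase j2) x = RR A T x := by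
    intro x hx hn
    ext y
    rw [mem_RR, mem_RR, memT]
    constructor
    · rintro ⟨⟨a, b⟩, c⟩; exact ⟨a, c⟩
    · rintro ⟨a, c⟩; exact ⟨⟨a, fun b => hn ((blk x hx y a c).2 b)⟩, c⟩
  have CCe : ∀ y ∈ T, ¬ (y = j1 ∨ y = j2) → CC A ((S.erase i).erase k) y = CC A S y := by
    intro y hy hn
    ext x
    rw [mem_CC, mem_CC, memS]
    constructor
    · rintro ⟨⟨a, b⟩, c⟩; exact ⟨a, c⟩
    · rintro ⟨a, c⟩; exact ⟨⟨a, fun b => hn ((blk x a y hy c).1 b)⟩, c⟩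
  have rblk : ∀ x, (x = i ∨ x = k) → RR A T x = {j1, j2} := by
    rintro x (rfl | rfl)
    · exact hj
    · exact Rk
  have cblk : ∀ y, (y = j1 ∨ y = j2) → CC A S y = {i, k} := by
    rintro x (rfl | rfl)
    · exact C1
    · exact C2
  refine ⟨?_, ?_, ?_, ?_⟩
  · intro x hx
    by_cases hb : x = i ∨ x = k
    · left; rw [rblk x hb, Finset.card_pair hne]
    · rw [← RRe x hx hb]; exact g1 x ((memS x).2 ⟨hx, hb⟩)
  · intro y hy
    by_cases hb : y = j1 ∨ y = j2
    · left; rw [cblk y hb, Finset.card_pair hki.symm]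
    · rw [← CCe y hy hb]; exact g2 y ((memT y).2 ⟨hy, hb⟩)
  · intro x hx y hy hxy
    by_cases hb : x = i ∨ x = k
    · rw [rblk x hb, cblk y ((blk x hx y hy hxy).1 hb), Finset.card_pair hki.symm, Finset.card_pair hne]
    · have hb' := fun z => hb ((blk x hx y hy hxy).2 z)
      rw [← RRe x hx hb, ← CCe y hy hb']
      exact g3 x ((memS x).2 ⟨hx, hb⟩) y ((memT y).2 ⟨hy, hb'⟩) hxy
  · intro x hx x' hx' y hy y' hy' a b c
    by_cases hb : x = i ∨ x = k
    · have hy1 := (blk x hx y hy a).1 hb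
      have hx1 := (blk x' hx' y hy b).2 hy1
      have hy2 := (blk x hx y' hy' c).1 hb
      have : y' ∈ RR A T x' := by rw [rblk x' hx1]; simpa using hy2
      exact (mem_RR.1 this).2
    · have hy1 := fun z => hb ((blk x hx y hy a).2 z)
      have hx1 := fun z => hy1 ((blk x' hx' y hy b).1 z)
      have hy2 := fun z => hb ((blk x hx y' hy' c).2 z)
      exact g4 x ((memS x).2 ⟨hx, hb⟩) x' ((memS x').2 ⟨hx', hx1⟩) y ((memT y).2 ⟨hy, hy1⟩)
        y' ((memT y').2 ⟨hy', hy2⟩) a b c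

lemma main_claim (m : ℕ) : ∀ (A : α → α → Bool) (S T : Finset α), S.card = m → T.card = m →
    Claim A S T m := by
  induction m using Nat.strong_induction_on with
  | _ m IH =>
  intro A S T hS hT
  rcases m with _ | m
  · rw [Finset.card_eq_zero] at hS hT
    subst hS hT
    refine ⟨?_, fun _ => ⟨by simp, by simp, by simp, by simp⟩⟩
    have : NN A (∅ : Finset α) ∅ ≤ 1 := by
      unfold NN
      rw [Nat.card_eq_fintype_card]
      apply Fintype.card_le_one_iff_subsingleton.2
      infer_instance
    have e : EE A (∅ : Finset α) ∅ = 0 := by simp [EE]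
    rw [e]; unfold WW
    simpa using this
  have ih : ∀ (A : α → α → Bool) (S T : Finset α), S.card = m+1 → T.card = m+1 →
      ∀ i ∈ S, ∀ j ∈ T, Claim A (S.erase i) (T.erase j) m := by
    intro A S T hS hT i hi j hj
    apply IH m (by omega)
    · rw [Finset.card_erase_of_mem hi]; omega
    · rw [Finset.card_erase_of_mem hj]; omega
  obtain ⟨i0, hi0⟩ : S.Nonempty := Finset.card_pos.1 (by omega)
  by_cases a1 : ∃ i ∈ S, (RR A T i).card ≤ 1
  · obtain ⟨i, hi, h⟩ := a1
    exact L1 A S T (ih A S T hS hT) i hi h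
  by_cases a2 : ∃ j ∈ T, (CC A S j).card ≤ 1
  · obtain ⟨i, hi, h⟩ := a2
    exact Claim_tr _ _ _ (L1 (tr A) T S (ih _ T S hT hS) i hi h)
  push Not at a1 a2
  have big : 2 ≤ m + 1 := by
    rw [← hT]
    exact (a1 i0 hi0).trans_le (Finset.card_le_card (Finset.filter_subset _ _))
  obtain ⟨m, rfl⟩ : ∃ m', m = m' + 1 := ⟨m - 1, by omega⟩
  have ih2 : ∀ (A : α → α → Bool) (S T : Finset α), S.card = m+1+1 → T.card = m+1+1 →
      ∀ i ∈ S, ∀ k ∈ S, k ≠ i → ∀ j ∈ T, ∀ j' ∈ T, j' ≠ j →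
      Claim A ((S.erase i).erase k) ((T.erase j).erase j') m := by
    intro A S T hS hT i hi k hk hki j hj j' hj' hjj
    apply IH m (by omega)
    · rw [Finset.card_erase_of_mem (Finset.mem_erase.2 ⟨hki, hk⟩), Finset.card_erase_of_mem hi]; omega
    · rw [Finset.card_erase_of_mem (Finset.mem_erase.2 ⟨hjj, hj'⟩), Finset.card_erase_of_mem hj]; omega
  by_cases b1 : ∃ i ∈ S, (RR A T i).card = 2
  · obtain ⟨i, hi, h⟩ := b1
    exact L2 A S T (ih A S T hS hT) (ih2 A S T hS hT) i hi h a1 a2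
  by_cases b2 : ∃ j ∈ T, (CC A S j).card = 2
  · obtain ⟨i, hi, h⟩ := b2
    exact Claim_tr _ _ _ (L2 (tr A) T S (ih _ T S hT hS) (ih2 _ T S hT hS) i hi h a2 a1)
  push Not at b1 b2
  have c1 : ∀ i ∈ S, 3 ≤ (RR A T i).card := fun i hi => by
    have := a1 i hi; have := b1 i hi; omega
  have c2 : ∀ j ∈ T, 3 ≤ (CC A S j).card := fun i hi => by
    have := a2 i hi; have := b2 i hi; omega
  by_cases d1 : ∃ i ∈ S, (RR A T i).card = 3
  · obtain ⟨i, hi, h⟩ := d1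
    exact L3 A S T hS hT (ih A S T hS hT) i hi h c1 c2
  by_cases d2 : ∃ j ∈ T, (CC A S j).card = 3
  · obtain ⟨i, hi, h⟩ := d2
    exact Claim_tr _ _ _ (L3 (tr A) T S hT hS (ih _ T S hT hS) i hi h c2 c1)
  push Not at d1 d2
  exact L4 A S T (ih A S T hS hT) i0 hi0
    (by have := c1 i0 hi0; have := d1 i0 hi0; omega)
    (fun j hj => by have := c2 j hj; have := d2 j hj; omega)

end

section final

def toB {n : ℕ} (A : Matrix (Fin n) (Fin n) ℕ) : Fin n → Fin n → Bool := fun i j => decide (A i j = 1)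

lemma toB_iff {n : ℕ} (A : Matrix (Fin n) (Fin n) ℕ) (i j) : toB A i j = true ↔ A i j = 1 := by
  simp [toB]

lemma perm_card {n : ℕ} (A : Matrix (Fin n) (Fin n) ℕ) (h : IsZeroOne A) :
    perm A = Nat.card {φ : Equiv.Perm (Fin n) // ∀ i, A i (φ i) = 1} := by
  rw [Nat.card_eq_fintype_card, Fintype.card_subtype, Finset.card_filter]
  unfold perm
  apply Finset.sum_congr rfl
  intro φ _
  split_ifs with hh
  · exact Finset.prod_eq_one (fun i _ => hh i)
  · push Not at hh
    obtain ⟨i, hi⟩ := hh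
    exact Finset.prod_eq_zero (Finset.mem_univ i) ((h i (φ i)).resolve_right hi)

lemma perm_NN {n : ℕ} (A : Matrix (Fin n) (Fin n) ℕ) (h : IsZeroOne A) :
    perm A = NN (toB A) Finset.univ Finset.univ := by
  rw [perm_card A h]
  unfold NN
  apply Nat.card_congr
  let u : {x // x ∈ (Finset.univ : Finset (Fin n))} ≃ Fin n := Equiv.subtypeUnivEquiv (fun x => Finset.mem_univ x)
  refine Equiv.subtypeEquiv (Equiv.equivCongr u.symm u.symm) ?_
  intro φ
  simp only [toB_iff]
  constructor
  · intro h i; exact h i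
  · intro h i; exact h ⟨i, Finset.mem_univ i⟩

lemma zero_EE {n : ℕ} (A : Matrix (Fin n) (Fin n) ℕ) (h : IsZeroOne A) :
    zeroCount A + EE (toB A) Finset.univ Finset.univ = n ^ 2 := by
  have e1 : EE (toB A) Finset.univ Finset.univ =
      (Finset.univ.filter fun p : Fin n × Fin n => ¬ A p.1 p.2 = 0).card := by
    unfold EE RR
    simp only [Finset.card_filter, Fintype.sum_prod_type]
    refine Finset.sum_congr rfl fun i _ => Finset.sum_congr rfl fun j _ => ?_
    rcases h i j with h | h <;> simp [toB, h]
  rw [e1]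
  unfold zeroCount
  rw [Finset.card_filter_add_card_filter_not]
  simp [pow_two]

lemma fiber_equiv {α α' X : Type} [Fintype α] [Fintype α'] [DecidableEq X] (u : α → X) (v : α' → X)
    (h : ∀ x, Fintype.card {a // u a = x} = Fintype.card {a // v a = x}) :
    ∃ e : α ≃ α', ∀ a, v (e a) = u a := by
  refine ⟨(Equiv.sigmaFiberEquiv u).symm.trans ((Equiv.sigmaCongrRight fun x =>
    Fintype.equivOfCardEq (h x)).trans (Equiv.sigmaFiberEquiv v)), fun a => ?_⟩
  exact (Fintype.equivOfCardEq (h (u a)) ⟨a, rfl⟩).2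

def ee (k l n : ℕ) (h : k * 3 + l * 2 = n) : (Fin k × Fin 3) ⊕ (Fin l × Fin 2) ≃ Fin n :=
  ((Equiv.sumCongr finProdFinEquiv finProdFinEquiv).trans finSumFinEquiv).trans (finCongr h)

def lab {k l : ℕ} : (Fin k × Fin 3) ⊕ (Fin l × Fin 2) → Fin k ⊕ Fin l := Sum.map Prod.fst Prod.fst

def blab (k l n : ℕ) (h : k * 3 + l * 2 = n) (i : Fin n) : Fin k ⊕ Fin l := lab ((ee k l n h).symm i)

lemma card_lab {k l : ℕ} (y : Fin k ⊕ Fin l) :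
    Fintype.card {x : (Fin k × Fin 3) ⊕ (Fin l × Fin 2) // lab x = y} = Sum.elim (fun _ => 3) (fun _ => 2) y := by
  rw [Fintype.card_subtype, Finset.card_filter, Fintype.sum_sum_type, Fintype.sum_prod_type, Fintype.sum_prod_type]
  rcases y with a | b <;> simp [lab, ← Finset.sum_mul]

lemma card_blab (k l n : ℕ) (h : k * 3 + l * 2 = n) (y : Fin k ⊕ Fin l) :
    Fintype.card {i : Fin n // blab k l n h i = y} = Sum.elim (fun _ => 3) (fun _ => 2) y := by
  rw [← card_lab y]
  exact Fintype.card_congr (Equiv.subtypeEquiv (ee k l n h).symm (fun a => Iff.rfl))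

lemma blockIdx_rep2 (l : ℕ) : ∀ x, x < l * 2 → blockIdx (List.replicate l 2) x = x / 2 := by
  induction l with
  | zero => intro x hx; omega
  | succ l ih =>
    intro x hx
    rw [List.replicate_succ, blockIdx]
    split_ifs with h
    · omega
    · rw [ih _ (by omega)]; omega

lemma blockIdx_rep (k l : ℕ) : ∀ x, x < k * 3 + l * 2 →
    blockIdx (List.replicate k 3 ++ List.replicate l 2) x =
      if x < k * 3 then x / 3 else k + (x - k * 3) / 2 := by
  induction k with
  | zero => intro x hx; simpa using blockIdx_rep2 l x (by omega)
  | succ k ih =>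
    intro x hx
    rw [List.replicate_succ, List.cons_append, blockIdx]
    by_cases h : x < 3
    · rw [if_pos h, if_pos (by omega)]; omega
    · rw [if_neg h, ih _ (by omega)]
      split_ifs <;> omega

lemma blockIdx_ee (k l n : ℕ) (h : k * 3 + l * 2 = n) (x) :
    blockIdx (List.replicate k 3 ++ List.replicate l 2) (ee k l n h x) =
      Sum.elim (fun a : Fin k => (a : ℕ)) (fun b : Fin l => k + (b : ℕ)) (lab x) := by
  rw [blockIdx_rep k l _ (by rw [h]; exact (ee k l n h x).2)]
  rcases x with ⟨a, r⟩ | ⟨b, r⟩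
  · have : ((ee k l n h (Sum.inl (a, r)) : Fin n) : ℕ) = r + 3 * a := by
      simp [ee]
    rw [this, if_pos (by omega)]
    simp [lab]; omega
  · have : ((ee k l n h (Sum.inr (b, r)) : Fin n) : ℕ) = k * 3 + (r + 2 * b) := by
      simp [ee]
    rw [this, if_neg (by omega)]
    simp [lab]; omega

lemma listBlocks_eq (k l n : ℕ) (h : k * 3 + l * 2 = n) (i j : Fin n) :
    listBlocks n (List.replicate k 3 ++ List.replicate l 2) i j =
      if blab k l n h i = blab k l n h j then 1 else 0 := by
  have key : ∀ i, blockIdx (List.replicate k 3 ++ List.replicate l 2) (i : Fin n) =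
      Sum.elim (fun a : Fin k => (a : ℕ)) (fun b : Fin l => k + (b : ℕ)) (blab k l n h i) := by
    intro i
    rw [blab, ← blockIdx_ee k l n h, Equiv.apply_symm_apply]
  have inj : ∀ x y : Fin k ⊕ Fin l, Sum.elim (fun a : Fin k => (a : ℕ)) (fun b : Fin l => k + (b : ℕ)) x =
      Sum.elim (fun a : Fin k => (a : ℕ)) (fun b : Fin l => k + (b : ℕ)) y ↔ x = y := by
    rintro (x | x) (y | y) <;> simp [Fin.ext_iff] <;> omega
  unfold listBlocks
  simp only [Matrix.of_apply, key, inj]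

lemma zeroOne_F (k l n : ℕ) (h : k * 3 + l * 2 = n) :
    IsZeroOne (listBlocks n (List.replicate k 3 ++ List.replicate l 2)) := by
  intro i j
  rw [listBlocks_eq k l n h]
  split_ifs <;> simp

lemma EE_F (k l n : ℕ) (h : k * 3 + l * 2 = n) :
    EE (toB (listBlocks n (List.replicate k 3 ++ List.replicate l 2))) Finset.univ Finset.univ =
      9 * k + 4 * l := by
  unfold EE RR
  have : ∀ i, (Finset.univ.filter (fun j => toB (listBlocks n (List.replicate k 3 ++ List.replicate l 2)) i j = true)).card
      = Sum.elim (fun _ => 3) (fun _ => 2) (blab k l n h i) := by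
    intro i
    rw [← card_blab k l n h, Fintype.card_subtype]
    congr 1
    ext j
    simp only [Finset.mem_filter, Finset.mem_univ, true_and, toB_iff, listBlocks_eq k l n h]
    rw [eq_comm (a := blab k l n h j)]
    split_ifs with hh <;> simp [hh]
  simp only [this]
  rw [← (ee k l n h).sum_comp]
  simp only [blab, Equiv.symm_apply_apply, Fintype.sum_sum_type]
  simp [lab]; ring

lemma perm_F (k l n : ℕ) (h : k * 3 + l * 2 = n) :
    perm (listBlocks n (List.replicate k 3 ++ List.replicate l 2)) = 6 ^ k * 2 ^ l := by
  rw [perm_card _ (zeroOne_F k l n h)]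
  have e : Nat.card {φ : Equiv.Perm (Fin n) //
      ∀ i, listBlocks n (List.replicate k 3 ++ List.replicate l 2) i (φ i) = 1} =
      Nat.card {φ : Equiv.Perm (Fin n) // blab k l n h ∘ φ = blab k l n h} := by
    apply Nat.card_congr
    apply Equiv.subtypeEquivRight
    intro φ
    rw [funext_iff]
    apply forall_congr'
    intro i
    rw [listBlocks_eq k l n h, eq_comm (a := (blab k l n h ∘ φ) i)]
    simp
  rw [e, Nat.card_eq_fintype_card, DomMulAct.stabilizer_card]
  simp only [card_blab, Fintype.prod_sum_type]
  simp [Nat.factorial]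

lemma mul_perm {n : ℕ} (P Q A : Matrix (Fin n) (Fin n) ℕ) (e f : Equiv.Perm (Fin n))
    (hP : ∀ i j, P i j = if j = e i then 1 else 0) (hQ : ∀ i j, Q i j = if j = f i then 1 else 0) :
    P * A * Q = A.submatrix e f.symm := by
  ext i j
  simp only [Matrix.mul_apply, hP, hQ, Matrix.submatrix_apply]
  simp only [ite_mul, one_mul, zero_mul, Finset.sum_ite_eq', Finset.sum_ite_eq, Finset.mem_univ, if_true]
  have : ∀ x, (j = f x) ↔ (x = f.symm j) := fun x => by
    rw [Equiv.eq_symm_apply]; exact eq_comm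
  simp [this]

lemma perm_eq_permanent {n : ℕ} (A : Matrix (Fin n) (Fin n) ℕ) : perm A = A.permanent := by
  rw [← Matrix.permanent_transpose]; rfl

lemma perm_submatrix {n : ℕ} (A : Matrix (Fin n) (Fin n) ℕ) (e f : Equiv.Perm (Fin n)) :
    perm (A.submatrix e f) = perm A := by
  rw [perm_eq_permanent, perm_eq_permanent]
  have : A.submatrix e f = (A.submatrix e id).submatrix id f := rfl
  rw [this, Matrix.permanent_permute_rows, Matrix.permanent_permute_cols]

lemma perm_combEquiv {n : ℕ} (A B : Matrix (Fin n) (Fin n) ℕ) (h : CombEquiv A B) : perm A = perm B := by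
  obtain ⟨P, Q, ⟨e, he⟩, ⟨f, hf⟩, h | h⟩ := h
  · rw [h, mul_perm P Q A e f he hf, perm_submatrix]
  · rw [h, mul_perm P Q _ e f he hf, perm_submatrix, perm_eq_permanent, perm_eq_permanent,
      Matrix.permanent_transpose]

lemma combEquiv_of {n : ℕ} (A B : Matrix (Fin n) (Fin n) ℕ) (e f : Equiv.Perm (Fin n))
    (h : ∀ i j, A i j = B (e i) (f j)) : CombEquiv A B := by
  refine ⟨Matrix.of fun i j => if j = e.symm i then 1 else 0, Matrix.of fun i j => if j = f i then 1 else 0,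
    ⟨e.symm, fun i j => rfl⟩, ⟨f, fun i j => rfl⟩, Or.inl ?_⟩
  rw [mul_perm (Matrix.of fun i j => if j = e.symm i then 1 else 0)
    (Matrix.of fun i j => if j = f i then 1 else 0) A e.symm f (fun i j => rfl) (fun i j => rfl)]
  ext i j
  simp [h]

lemma good_comb (k l n : ℕ) (hn : k * 3 + l * 2 = n) (A : Matrix (Fin n) (Fin n) ℕ)
    (h01 : IsZeroOne A) (hG : Good (toB A) Finset.univ Finset.univ)
    (hE : EE (toB A) Finset.univ Finset.univ = 9 * k + 4 * l) :
    CombEquiv A (listBlocks n (List.replicate k 3 ++ List.replicate l 2)) := by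
  classical
  obtain ⟨g1, g2, g3, g4⟩ := hG
  simp only [Finset.mem_univ, true_implies] at g1 g2 g3 g4
  set R := RR (toB A) Finset.univ with hR
  set C := CC (toB A) Finset.univ with hC
  have memR : ∀ i j, j ∈ R i ↔ toB A i j = true := fun i j => by rw [hR, mem_RR]; simp
  have memC : ∀ i j, i ∈ C j ↔ toB A i j = true := fun i j => by rw [hC, mem_CC]; simp
  have Req : ∀ i i' j, toB A i j = true → toB A i' j = true → R i = R i' := by
    intro i i' j a b
    ext y
    rw [memR, memR]
    exact ⟨fun c => g4 i i' j y a b c, fun c => g4 i' i j y b a c⟩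
  have hρ : ∀ j, ∃ i, toB A i j = true := by
    intro j
    have : 0 < (C j).card := by have := g2 j; omega
    obtain ⟨i, hi⟩ := Finset.card_pos.1 this
    exact ⟨i, (memC i j).1 hi⟩
  choose ρ hρ using hρ
  let B := {b : Finset (Fin n) // b ∈ Finset.univ.image R}
  let p : Fin n → B := fun i => ⟨R i, Finset.mem_image_of_mem _ (Finset.mem_univ i)⟩
  let q : Fin n → B := fun j => p (ρ j)
  have hpq : ∀ i j, toB A i j = true ↔ p i = q j := by
    intro i j
    constructor
    · intro h; exact Subtype.ext (Req _ _ j h (hρ j))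
    · intro h
      have : R i = R (ρ j) := congrArg Subtype.val h
      rw [← memR, this, memR]; exact hρ j
  have surj : ∀ b : B, ∃ i, p i = b := by
    rintro ⟨b, hb⟩
    obtain ⟨i, _, rfl⟩ := Finset.mem_image.1 hb
    exact ⟨i, rfl⟩
  have fp : ∀ b : B, Fintype.card {i // p i = b} = b.1.card := by
    intro b
    obtain ⟨i, rfl⟩ := surj b
    have : 0 < (R i).card := by have := g1 i; omega
    obtain ⟨j, hj⟩ := Finset.card_pos.1 this
    rw [memR] at hj
    show _ = (R i).card
    rw [g3 i j hj, Fintype.card_subtype]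
    congr 1
    ext x
    rw [memC, hpq x j, ← (hpq i j).1 hj]; simp
  have fq : ∀ b : B, Fintype.card {j // q j = b} = b.1.card := by
    intro b
    obtain ⟨i, rfl⟩ := surj b
    show _ = (R i).card
    rw [Fintype.card_subtype]
    congr 1
    ext x
    rw [memR, hpq i x, eq_comm]; simp
  have hB : ∀ b : B, b.1.card = 2 ∨ b.1.card = 3 := by
    intro b
    obtain ⟨i, rfl⟩ := surj b
    exact g1 i
  -- counting
  have cardsum : ∀ F : B → ℕ, ∑ i, F (p i) = ∑ b : B, b.1.card * F b := by
    intro F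
    rw [← Finset.sum_fiberwise Finset.univ p]
    apply Finset.sum_congr rfl
    intro b _
    rw [← fp b, Fintype.card_subtype, Finset.sum_congr rfl (g := fun _ => F b), Finset.sum_const, smul_eq_mul]
    intro x hx
    rw [(Finset.mem_filter.1 hx).2]
  have n1 : n = ∑ b : B, b.1.card := by
    have := cardsum (fun _ => 1)
    simpa using this
  have n2 : 9 * k + 4 * l = ∑ b : B, b.1.card * b.1.card := by
    rw [← hE, ← cardsum (fun b => b.1.card)]; rfl
  have split : ∀ F : ℕ → ℕ, ∑ b : B, F b.1.card =
      Fintype.card {b : B // b.1.card = 3} * F 3 + Fintype.card {b : B // ¬ b.1.card = 3} * F 2 := by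
    intro F
    rw [← Finset.sum_filter_add_sum_filter_not Finset.univ (fun b : B => b.1.card = 3),
      Fintype.card_subtype, Fintype.card_subtype]
    congr 1
    · rw [Finset.sum_congr rfl (g := fun _ => F 3), Finset.sum_const, smul_eq_mul]
      intro x hx
      rw [(Finset.mem_filter.1 hx).2]
    · rw [Finset.sum_congr rfl (g := fun _ => F 2), Finset.sum_const, smul_eq_mul]
      intro x hx
      rw [(hB x).resolve_right (Finset.mem_filter.1 hx).2]
  have s1 := split id
  have s2 := split (fun x => x * x)
  simp only [id] at s1
  rw [← n1] at s1
  rw [← n2] at s2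
  have ck : Fintype.card {b : B // b.1.card = 3} = k := by omega
  have cl : Fintype.card {b : B // ¬ b.1.card = 3} = l := by omega
  let g : B ≃ Fin k ⊕ Fin l := (Equiv.sumCompl (fun b : B => b.1.card = 3)).symm.trans
    (Equiv.sumCongr (Fintype.equivFinOfCardEq ck) (Fintype.equivFinOfCardEq cl))
  have gs : ∀ y, (g.symm y).1.card = Sum.elim (fun _ => 3) (fun _ => 2) y := by
    rintro (a | b)
    · exact ((Fintype.equivFinOfCardEq ck).symm a).2
    · exact (hB _).resolve_right ((Fintype.equivFinOfCardEq cl).symm b).2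
  obtain ⟨e, he⟩ := fiber_equiv (fun i => g (p i)) (blab k l n hn) (by
    intro y
    rw [card_blab, ← gs, ← fp]
    exact Fintype.card_congr (Equiv.subtypeEquivRight fun i => by rw [Equiv.eq_symm_apply]))
  obtain ⟨f, hf⟩ := fiber_equiv (fun i => g (q i)) (blab k l n hn) (by
    intro y
    rw [card_blab, ← gs, ← fq]
    exact Fintype.card_congr (Equiv.subtypeEquivRight fun i => by rw [Equiv.eq_symm_apply]))
  apply combEquiv_of _ _ e f
  intro i j
  rw [listBlocks_eq k l n hn, he, hf]
  simp only [g.injective.eq_iff, ← hpq, toB_iff]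
  rcases h01 i j with h | h <;> simp [h]

lemma WW_val (k l n : ℕ) (h : k * 3 + l * 2 = n) : WW n (9 * k + 4 * l) = 6 ^ k * 2 ^ l := by
  unfold WW
  subst h
  have hp := pp_pos.ne'
  have a : cc ^ 3 * pp⁻¹ ^ 9 = 6 := by
    have : cc ^ 3 * pp⁻¹ ^ 9 = 27 * pp ^ 6 := by unfold cc; field_simp; ring
    rw [this, pp6]; norm_num
  have b : cc ^ 2 * pp⁻¹ ^ 4 = 2 := by
    have : cc ^ 2 * pp⁻¹ ^ 4 = 9 * pp ^ 6 := by unfold cc; field_simp; ring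
    rw [this, pp6]; norm_num
  rw [← a, ← b]
  simp only [mul_pow, ← pow_mul, pow_add]
  rw [mul_comm k 3, mul_comm l 2]; ring

end final

theorem stmt3 (n τ σ : ℕ) (hn : 8 ≤ n)
    (hτ1 : n ^ 2 - 3 * n ≤ τ) (hτ2 : τ ≤ n ^ 2 - 2 * n - 1)
    (hσ : σ = n ^ 2 - τ)
    (hmod : (σ - 2 * n) % 3 = 0) (heven : Even (3 * n - σ)) :
    mu n τ = 6 ^ ((σ - 2 * n) / 3) * 2 ^ ((3 * n - σ) / 2) ∧
    ∀ A ∈ Uclass n τ, (perm A = mu n τ ↔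
      CombEquiv A (listBlocks n
        (List.replicate ((σ - 2 * n) / 3) 3 ++ List.replicate ((3 * n - σ) / 2) 2))) := by
  have hn2 : 8 * n ≤ n ^ 2 := by nlinarith
  obtain ⟨k, hk⟩ : ∃ k, k = (σ - 2 * n) / 3 := ⟨_, rfl⟩
  obtain ⟨l, hl⟩ : ∃ l, l = (3 * n - σ) / 2 := ⟨_, rfl⟩
  rw [← hk, ← hl]
  obtain ⟨r, hr⟩ := heven
  have hkl : k * 3 + l * 2 = n := by omega
  have hs : 9 * k + 4 * l = σ := by omega
  have hEA : ∀ A ∈ Uclass n τ, EE (toB A) Finset.univ Finset.univ = 9 * k + 4 * l := by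
    intro A hA
    have := zero_EE A hA.1
    have := hA.2
    omega
  have hcl : ∀ A ∈ Uclass n τ, perm A ≤ 6 ^ k * 2 ^ l ∧ (perm A = 6 ^ k * 2 ^ l →
      CombEquiv A (listBlocks n (List.replicate k 3 ++ List.replicate l 2))) := by
    intro A hA
    have := main_claim n (toB A) Finset.univ Finset.univ (by simp) (by simp)
    unfold Claim at this
    rw [hEA A hA, WW_val k l n hkl, ← perm_NN A hA.1] at this
    refine ⟨by exact_mod_cast this.1, fun h => ?_⟩
    exact good_comb k l n hkl A hA.1 (this.2 (by rw [h]; push_cast; ring)) (hEA A hA)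
  have hF : listBlocks n (List.replicate k 3 ++ List.replicate l 2) ∈ Uclass n τ := by
    refine ⟨zeroOne_F k l n hkl, ?_⟩
    have := zero_EE _ (zeroOne_F k l n hkl)
    rw [EE_F k l n hkl] at this
    omega
  have hmu : mu n τ = 6 ^ k * 2 ^ l := by
    unfold mu
    apply IsGreatest.csSup_eq
    refine ⟨⟨_, hF, perm_F k l n hkl⟩, ?_⟩
    rintro _ ⟨A, hA, rfl⟩
    exact (hcl A hA).1
  refine ⟨hmu, fun A hA => ?_⟩
  rw [hmu]
  exact ⟨(hcl A hA).2, fun h => by rw [perm_combEquiv _ _ h, perm_F k l n hkl]⟩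

end BGM
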